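/- Let m = (m₁,m₂,m₃) : ℝ → ℝ³ be continuously differentiable with |m(x)| = 1 for all x, with finite ℋ¹ seminorm, and such that the first component m₁ is not a constant function. Then for every ε > 0 there exists δ > 0 (depending on m) such that for every continuously differentiable m̃ : ℝ → ℝ³ with |m̃(x)| = 1 for all x, finite ℋ¹ seminorm, and ‖m − m̃‖_{ℋ¹} ≤ δ, one has m − m̃ ∈ L² and ‖m − m̃‖_{H¹} ≤ ε; in particular m and m̃ have the same limits at ±∞. -/

import Mathlib

open MeasureTheory Filter ENNReal

noncomputable section

abbrev E3 := EuclideanSpace ℝ (Fin 3)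

/-- canonical basis vectors of ℝ³ -/
def e1 : E3 := !₂[1, 0, 0]
def e2 : E3 := !₂[0, 1, 0]
def e3 : E3 := !₂[0, 0, 1]

/-- cross product in ℝ³ -/
def cross3 (a b : E3) : E3 :=
  !₂[a 1 * b 2 - a 2 * b 1, a 2 * b 0 - a 0 * b 2, a 0 * b 1 - a 1 * b 0]

/-- scalar product in ℝ³ -/
def dot3 (a b : E3) : ℝ := a 0 * b 0 + a 1 * b 1 + a 2 * b 2

/-- θ_*(x) = 2 arctan (exp (−√(1−γ²) x)) -/
def thetaStar (γ x : ℝ) : ℝ := 2 * Real.arctan (Real.exp (-Real.sqrt (1 - γ ^ 2) * x))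

/-- φ_*(x) = −γ x -/
def phiStar (γ x : ℝ) : ℝ := -γ * x

/-- the domain walls w_*^± (s = ±1 is the sign) -/
def wStar (γ s x : ℝ) : E3 :=
  !₂[Real.cos (thetaStar γ x),
    s * (Real.sin (thetaStar γ x) * Real.cos (phiStar γ x)),
    s * (Real.sin (thetaStar γ x) * Real.sin (phiStar γ x))]

/-- rotation about the axis e₁ by angle φ -/
def rot (φ : ℝ) (v : E3) : E3 :=
  !₂[v 0, v 1 * Real.cos φ - v 2 * Real.sin φ, v 1 * Real.sin φ + v 2 * Real.cos φ]

/-- the energy gradient δE(m) = −m″ − 2γ e₁ ∧ m′ + m₂e₂ + m₃e₃ -/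
def deltaE (γ : ℝ) (m : ℝ → E3) (x : ℝ) : E3 :=
  -(deriv (deriv m) x) - (2 * γ) • cross3 e1 (deriv m x) + (m x 1) • e2 + (m x 2) • e3

/-- the L² norm of a function on ℝ -/
def L2norm {E : Type*} [NormedAddCommGroup E] (u : ℝ → E) : ℝ :=
  (eLpNorm u 2 volume).toReal

/-- the H¹ norm ‖u‖_{L²} + ‖u′‖_{L²} -/
def H1norm {E : Type*} [NormedAddCommGroup E] [NormedSpace ℝ E] (u : ℝ → E) : ℝ :=
  L2norm u + L2norm (deriv u)

/-- the ℋ¹ seminorm ‖m₂‖_{L²} + ‖m₃‖_{L²} + ‖m′‖_{L²} -/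
def HH1 (m : ℝ → E3) : ℝ :=
  L2norm (fun x => m x 1) + L2norm (fun x => m x 2) + L2norm (deriv m)

/-- the micromagnetic energy E(m) -/
def energy (γ : ℝ) (m : ℝ → E3) : ℝ :=
  (1 / 2) * ∫ x : ℝ,
    (‖deriv m x‖ ^ 2 + 2 * γ * dot3 (deriv m x) (cross3 e1 (m x)) + (1 - (m x 0) ^ 2))

theorem aux_holder (u : ℝ → E3) (hu : ContDiff ℝ 1 u) (hd : MemLp (deriv u) 2 volume) (x y : ℝ) :
    ‖u y - u x‖ ≤ L2norm (deriv u) * Real.sqrt |y - x| := by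
  have hc : Continuous (deriv u) := hu.continuous_deriv le_rfl
  have h1 : ∫ t in x..y, deriv u t = u y - u x :=
    intervalIntegral.integral_deriv_eq_sub
      (fun t _ => (hu.differentiable (by norm_num)).differentiableAt)
      (hc.intervalIntegrable _ _)
  have h2 : ‖u y - u x‖ₑ ≤ eLpNorm (deriv u) 2 volume * (ENNReal.ofReal |y - x|) ^ (1/2 : ℝ) := by
    rw [← h1]
    have : ‖∫ t in x..y, deriv u t‖ₑ = ‖∫ t in Set.uIoc x y, deriv u t‖ₑ := by
      rw [← ofReal_norm, ← ofReal_norm, intervalIntegral.norm_integral_eq_norm_integral_uIoc]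
    rw [this]
    refine (enorm_integral_le_lintegral_enorm _).trans ?_
    rw [← eLpNorm_one_eq_lintegral_enorm]
    refine (eLpNorm_le_eLpNorm_mul_rpow_measure_univ (q := 2) (by norm_num)
      hc.aestronglyMeasurable).trans ?_
    have e : (1 / (1 : ℝ≥0∞).toReal - 1 / (2 : ℝ≥0∞).toReal) = (1/2 : ℝ) := by norm_num
    rw [e]
    gcongr
    · exact Measure.restrict_le_self
    · simp [Set.uIoc, Real.volume_Ioc, max_sub_min_eq_abs]
  have h3 := ENNReal.toReal_mono (by
    refine ENNReal.mul_ne_top hd.2.ne ?_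
    exact ENNReal.rpow_ne_top_of_nonneg (by norm_num) ENNReal.ofReal_ne_top) h2
  rw [ENNReal.toReal_mul, ← ENNReal.toReal_rpow, ENNReal.toReal_ofReal (abs_nonneg _),
    ← Real.sqrt_eq_rpow, toReal_enorm] at h3
  exact h3

theorem aux_sup (f : ℝ → ℝ) (K : ℝ) (hf : MemLp f 2 volume)
    (hK : ∀ x y, |f y - f x| ≤ K * Real.sqrt |y - x|) (x : ℝ) : |f x| ≤ L2norm f + K := by
  have hK0 : 0 ≤ K := by
    have := hK 0 1
    simp at this
    exact (abs_nonneg _).trans this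
  by_cases hc : |f x| - K ≤ 0
  · have : 0 ≤ L2norm f := ENNReal.toReal_nonneg
    linarith
  push Not at hc
  have h : eLpNorm ((Set.Ioc x (x+1)).indicator (fun _ => |f x| - K)) 2 volume
      ≤ eLpNorm f 2 volume := by
    refine eLpNorm_mono fun y => ?_
    by_cases hy : y ∈ Set.Ioc x (x+1)
    · rw [Set.indicator_of_mem hy, Real.norm_eq_abs, abs_of_pos hc, Real.norm_eq_abs]
      have h1 := hK x y
      have h2 : Real.sqrt |y - x| ≤ 1 := by
        refine Real.sqrt_le_one.2 ?_
        rw [abs_le]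
        constructor <;> linarith [hy.1, hy.2]
      have h3 : |f x| - |f y| ≤ |f y - f x| := by
        rw [abs_sub_comm (f y)]; exact abs_sub_abs_le_abs_sub _ _
      nlinarith
    · rw [Set.indicator_of_notMem hy]; simp
  rw [eLpNorm_indicator_const measurableSet_Ioc (by norm_num) (by norm_num)] at h
  have h' := ENNReal.toReal_mono hf.2.ne h
  simp [Real.volume_Ioc, abs_of_pos hc] at h'
  unfold L2norm
  linarith

theorem aux_contDiff_comp (m : ℝ → E3) (hreg : ContDiff ℝ 1 m) (i : Fin 3) (x : ℝ) :
    HasDerivAt (fun x => m x i) (deriv m x i) x := by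
  have h := ((hreg.differentiable (by norm_num)) x).hasDerivAt
  exact (EuclideanSpace.proj (𝕜 := ℝ) i : E3 →L[ℝ] ℝ).hasFDerivAt.comp_hasDerivAt x h

theorem aux_norm_sq (v : E3) : ‖v‖ ^ 2 = v 0 ^ 2 + v 1 ^ 2 + v 2 ^ 2 := by
  rw [EuclideanSpace.norm_sq_eq, Fin.sum_univ_three]; simp

theorem aux_coord_le (v : E3) (i : Fin 3) : |v i| ≤ ‖v‖ := by
  simpa using PiLp.norm_apply_le v i

theorem aux_memLp_coord (m : ℝ → E3) (hm : MemLp m 2 volume) (hc : Continuous m) (i : Fin 3) :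
    MemLp (fun x => m x i) 2 volume := by
  refine hm.of_le ?_ (Eventually.of_forall fun x => ?_)
  · exact (by fun_prop : Continuous fun x => m x i).aestronglyMeasurable
  · exact aux_coord_le (m x) i

theorem aux_tendsto_coord (m : ℝ → E3) (hreg : ContDiff ℝ 1 m) (hd : MemLp (deriv m) 2 volume)
    (i : Fin 3) (h : MemLp (fun x => m x i) 2 volume) :
    Tendsto (fun x => m x i) atTop (nhds 0) := by
  have hdi := aux_memLp_coord _ hd (hreg.continuous_deriv le_rfl) i
  have h1 : Tendsto (fun x => (m x i) ^ 2) atTop (nhds 0) := by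
    refine tendsto_zero_of_hasDerivAt_of_integrableOn_Ioi (a := 0)
      (f' := fun x => 2 * (m x i * deriv m x i)) ?_ ?_ ?_
    · intro x _
      have := (aux_contDiff_comp m hreg i x).pow 2
      refine this.congr_deriv ?_
      push_cast; ring
    · exact ((MemLp.integrable_mul h hdi).const_mul 2).integrableOn
    · exact h.integrable_sq.integrableOn
  have h2 := h1.sqrt
  simp only [Real.sqrt_sq_eq_abs, Real.sqrt_zero] at h2
  exact (tendsto_zero_iff_abs_tendsto_zero _).2 h2

theorem aux_tendsto_pi (m : ℝ → E3) (l : Filter ℝ) (p : E3) (h : ∀ i, Tendsto (fun x => m x i) l (nhds (p i))) :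
    Tendsto m l (nhds p) := by
  have := (PiLp.continuous_toLp 2 (fun _ : Fin 3 => ℝ)).continuousAt.tendsto.comp
    (tendsto_pi_nhds.2 h)
  exact this

theorem aux_limit (m : ℝ → E3) (hreg : ContDiff ℝ 1 m) (hsph : ∀ x, ‖m x‖ = 1)
    (h2 : MemLp (fun x => m x 1) 2 volume) (h3 : MemLp (fun x => m x 2) 2 volume)
    (hd : MemLp (deriv m) 2 volume) :
    (∃ p : E3, Tendsto m atTop (nhds p)) ∧ ∃ R, ∀ x ≥ R, 3 / 4 ≤ |m x 0| := by
  have t1 := aux_tendsto_coord m hreg hd 1 h2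
  have t2 := aux_tendsto_coord m hreg hd 2 h3
  have e : ∀ x, m x 0 ^ 2 = 1 - m x 1 ^ 2 - m x 2 ^ 2 := fun x => by
    have := aux_norm_sq (m x); rw [hsph] at this; linarith
  have hc : Continuous (fun x => m x 0) := by have := hreg.continuous; fun_prop
  have t3 : Tendsto (fun x => |m x 0|) atTop (nhds 1) := by
    have := (((t1.pow 2).const_sub 1).sub (t2.pow 2)).sqrt
    simp only [← e, Real.sqrt_sq_eq_abs] at this
    simpa using this
  obtain ⟨R, hR⟩ := eventually_atTop.1 (t3.eventually (eventually_ge_nhds (by norm_num : (3/4:ℝ) < 1)))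
  refine ⟨?_, R, hR⟩
  have key : ∃ s : ℝ, Tendsto (fun x => m x 0) atTop (nhds s) := by
    by_cases hs : 0 < m R 0
    · refine ⟨1, t3.congr' ?_⟩
      filter_upwards [eventually_ge_atTop R] with x hx
      rw [abs_of_nonneg]
      by_contra hneg
      push Not at hneg
      obtain ⟨y, hy, hy0⟩ := intermediate_value_Icc' hx hc.continuousOn ⟨hneg.le, hs.le⟩
      have h0 := hR y hy.1
      simp only at hy0
      rw [hy0] at h0; norm_num at h0
    · refine ⟨-1, t3.neg.congr' ?_⟩
      filter_upwards [eventually_ge_atTop R] with x hx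
      rw [abs_of_nonpos, neg_neg]
      by_contra hneg
      push Not at hneg hs
      obtain ⟨y, hy, hy0⟩ := intermediate_value_Icc hx hc.continuousOn ⟨hs, hneg.le⟩
      have h0 := hR y hy.1
      simp only at hy0
      rw [hy0] at h0; norm_num at h0
  obtain ⟨s, hs⟩ := key
  refine ⟨!₂[s, 0, 0], aux_tendsto_pi _ _ _ fun i => ?_⟩
  fin_cases i
  · simpa using hs
  · simpa using t1
  · simpa using t2

theorem aux_two_points (g : ℝ → ℝ) (hg : Continuous g) (hnc : ¬ ∃ c : ℝ, ∀ x : ℝ, g x = c) :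
    ∃ a b, g a ≠ 0 ∧ g b ≠ 0 ∧ g a ≠ g b := by
  have half : ∀ x y, g x = 0 → g y ≠ 0 → ∃ a, g a = g y / 2 := by
    intro x y hx hy
    rcases lt_or_gt_of_ne hy with h | h
    · exact mem_range_of_exists_le_of_exists_ge hg ⟨y, by linarith⟩ ⟨x, by linarith⟩
    · exact mem_range_of_exists_le_of_exists_ge hg ⟨x, by linarith⟩ ⟨y, by linarith⟩
  have : ∃ y, g y ≠ 0 := by
    by_contra h; push Not at h; exact hnc ⟨0, h⟩
  obtain ⟨y, hy⟩ := this
  have : ∃ x, g x ≠ g y := by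
    by_contra h; push Not at h; exact hnc ⟨_, h⟩
  obtain ⟨x, hx⟩ := this
  by_cases hx0 : g x = 0
  · obtain ⟨a, ha⟩ := half x y hx0 hy
    refine ⟨a, y, ?_, hy, ?_⟩
    · rw [ha]; simpa using hy
    · rw [ha]; intro h; apply hy; linarith
  · exact ⟨x, y, hx0, hy, hx⟩

/-- From `|p| |2α - p| ≤ c` get `|p|` small or `|2α - p|` small. -/
theorem aux_dich (α κ p c : ℝ) (hκ : 0 < κ) (hα : κ ≤ |α|) (h : |p| * |2 * α - p| ≤ c) :
    |p| ≤ c / κ ∨ |2 * α - p| ≤ c / κ := by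
  rw [le_div_iff₀ hκ, le_div_iff₀ hκ]
  by_cases hp : |p| < κ
  · left
    have : κ ≤ |2 * α - p| := by
      have := abs_sub_abs_le_abs_sub (2 * α) p
      rw [abs_mul, abs_two] at this
      linarith
    nlinarith [abs_nonneg p]
  · right
    push Not at hp
    nlinarith [abs_nonneg (2 * α - p)]

theorem aux_small (α β κ p q δ L : ℝ) (hκ : 0 < κ) (hα : κ ≤ |α|) (hβ : κ ≤ |β|)
    (hαβ : κ ≤ |α - β|) (hδ : δ * (8 / κ + L) < κ) (hL : 0 ≤ L) (hδ0 : 0 < δ)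
    (hp : |p| * |2 * α - p| ≤ 4 * δ) (hq : |q| * |2 * β - q| ≤ 4 * δ)
    (hpq : |q - p| ≤ δ * L) : |p| ≤ 4 * δ / κ := by
  rcases aux_dich α κ p _ hκ hα hp with h | h
  · exact h
  exfalso
  have e : δ * (8 / κ + L) = 2 * (4 * δ / κ) + δ * L := by ring
  have c0 : 0 < 4 * δ / κ := by positivity
  have d0 : 0 ≤ δ * L := by positivity
  rw [e] at hδ
  set c := 4 * δ / κ
  rw [abs_le] at hpq h
  rcases aux_dich β κ q _ hκ hβ hq with h' | h' <;> rw [abs_le] at h'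
  · rcases le_abs.1 hα with h1 | h1 <;> linarith [h.1, h.2, h'.1, h'.2, hpq.1, hpq.2]
  · rcases le_abs.1 hαβ with h1 | h1 <;> linarith [h.1, h.2, h'.1, h'.2, hpq.1, hpq.2]

/-- propagation of smallness along a half line -/
theorem aux_prop (u g : ℝ → ℝ) (R : ℝ) (hu : Continuous u) (hg : ∀ x ≥ R, 3 / 4 ≤ |g x|)
    (hprod : ∀ x, |u x| * |2 * g x - u x| < 1 / 2) (hR : |u R| ≤ 1 / 2) :
    ∀ x ≥ R, |u x| ≤ 1 / 2 := by
  intro x hx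
  by_contra h
  push Not at h
  obtain ⟨y, hy, hy0⟩ := intermediate_value_Icc hx hu.abs.continuousOn ⟨hR, h.le⟩
  simp only at hy0
  have h1 := hprod y
  have h2 := hg y hy.1
  have := abs_sub_abs_le_abs_sub (2 * g y) (u y)
  rw [abs_mul, abs_two] at this
  rw [hy0] at h1 this
  linarith

theorem aux_limit_bot (m : ℝ → E3) (hreg : ContDiff ℝ 1 m) (hsph : ∀ x, ‖m x‖ = 1)
    (h2 : MemLp (fun x => m x 1) 2 volume) (h3 : MemLp (fun x => m x 2) 2 volume)
    (hd : MemLp (deriv m) 2 volume) :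
    (∃ p : E3, Tendsto m atBot (nhds p)) ∧ (∃ R, ∀ x ≤ -R, 3 / 4 ≤ |m x 0|) ∧
      Tendsto (fun x => m x 1) atBot (nhds 0) ∧ Tendsto (fun x => m x 2) atBot (nhds 0) := by
  have mp : MeasurePreserving (fun x : ℝ => -x) volume volume := Measure.measurePreserving_neg volume
  have k1 : ContDiff ℝ 1 (fun x => m (-x)) := hreg.comp contDiff_neg
  have k2 : MemLp (fun x => m (-x) 1) 2 volume := h2.comp_measurePreserving mp
  have k3 : MemLp (fun x => m (-x) 2) 2 volume := h3.comp_measurePreserving mp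
  have k4 : MemLp (deriv (fun x => m (-x))) 2 volume := by
    have : deriv (fun x => m (-x)) = fun x => - deriv m (-x) := by
      funext x; exact deriv_comp_neg m x
    rw [this]
    exact (hd.comp_measurePreserving mp).neg
  obtain ⟨⟨p, hp⟩, R, hR⟩ := aux_limit _ k1 (fun x => hsph _) k2 k3 k4
  have t1 := aux_tendsto_coord _ k1 k4 1 k2
  have t2 := aux_tendsto_coord _ k1 k4 2 k3
  refine ⟨⟨p, ?_⟩, ⟨R, fun x hx => ?_⟩, ?_, ?_⟩
  · simpa [Function.comp_def] using hp.comp tendsto_neg_atBot_atTop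
  · simpa using hR (-x) (by linarith)
  · simpa [Function.comp_def] using t1.comp tendsto_neg_atBot_atTop
  · simpa [Function.comp_def] using t2.comp tendsto_neg_atBot_atTop

theorem aux_L2 (u : ℝ → E3) (hc : Continuous u) (R K : ℝ) (hR : 0 ≤ R) (hK : 0 ≤ K)
    (h2 : MemLp (fun x => u x 1) 2 volume) (h3 : MemLp (fun x => u x 2) 2 volume)
    (hin : ∀ x ∈ Set.Icc (-R) R, |u x 0| ≤ K)
    (hout : ∀ x, x ∉ Set.Icc (-R) R → |u x 0| ≤ 2 * |u x 1| + 2 * |u x 2|) :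
    MemLp u 2 volume ∧
      L2norm u ≤ 3 * L2norm (fun x => u x 1) + 3 * L2norm (fun x => u x 2)
        + K * Real.sqrt (2 * R) := by
  set f1 : ℝ → ℝ := fun x => 3 * |u x 1| with hf1
  set f2 : ℝ → ℝ := fun x => 3 * |u x 2| with hf2
  set f3 : ℝ → ℝ := (Set.Icc (-R) R).indicator (fun _ => K) with hf3
  have m1 : MemLp f1 2 volume := h2.abs.const_mul 3
  have m2 : MemLp f2 2 volume := h3.abs.const_mul 3
  have m3 : MemLp f3 2 volume := memLp_indicator_const 2 measurableSet_Icc K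
    (Or.inr (by simp [Real.volume_Icc]))
  have hb : ∀ x, ‖u x‖ ≤ (f1 + f2 + f3) x := by
    intro x
    have h1 : ‖u x‖ ≤ |u x 0| + |u x 1| + |u x 2| := by
      refine le_of_sq_le_sq ?_ (by positivity)
      rw [aux_norm_sq, ← sq_abs (u x 0), ← sq_abs (u x 1), ← sq_abs (u x 2)]
      have a0 := abs_nonneg (u x 0)
      have a1 := abs_nonneg (u x 1)
      have a2 := abs_nonneg (u x 2)
      nlinarith [mul_nonneg a0 a1, mul_nonneg a0 a2, mul_nonneg a1 a2]
    have a1 := abs_nonneg (u x 1)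
    have a2 := abs_nonneg (u x 2)
    simp only [Pi.add_apply, hf1, hf2, hf3]
    by_cases hx : x ∈ Set.Icc (-R) R
    · rw [Set.indicator_of_mem hx]
      linarith [hin x hx]
    · rw [Set.indicator_of_notMem hx]
      linarith [hout x hx]
  have m123 := (m1.add m2).add m3
  refine ⟨m123.mono' hc.aestronglyMeasurable (Eventually.of_forall hb), ?_⟩
  have n1 : eLpNorm f1 2 volume = ENNReal.ofReal (3 * L2norm (fun x => u x 1)) := by
    have : f1 = (3:ℝ) • (fun x => ‖u x 1‖) := by funext x; simp [hf1]
    rw [this, eLpNorm_const_smul, eLpNorm_norm, ENNReal.ofReal_mul (by norm_num), L2norm,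
      ENNReal.ofReal_toReal h2.2.ne]
    congr 1
    rw [← ofReal_norm]; norm_num
  have n2 : eLpNorm f2 2 volume = ENNReal.ofReal (3 * L2norm (fun x => u x 2)) := by
    have : f2 = (3:ℝ) • (fun x => ‖u x 2‖) := by funext x; simp [hf2]
    rw [this, eLpNorm_const_smul, eLpNorm_norm, ENNReal.ofReal_mul (by norm_num), L2norm,
      ENNReal.ofReal_toReal h3.2.ne]
    congr 1
    rw [← ofReal_norm]; norm_num
  have n3 : eLpNorm f3 2 volume = ENNReal.ofReal (K * Real.sqrt (2 * R)) := by
    rw [hf3, eLpNorm_indicator_const measurableSet_Icc (by norm_num) (by norm_num),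
      ENNReal.ofReal_mul hK, Real.volume_Icc, ← ofReal_norm, Real.norm_of_nonneg hK,
      ENNReal.ofReal_rpow_of_nonneg (by linarith) (by norm_num), Real.sqrt_eq_rpow]
    congr 3
    · ring
  have p1 : 0 ≤ L2norm (fun x => u x 1) := ENNReal.toReal_nonneg
  have p2 : 0 ≤ L2norm (fun x => u x 2) := ENNReal.toReal_nonneg
  have tot : eLpNorm u 2 volume ≤ ENNReal.ofReal (3 * L2norm (fun x => u x 1) +
      3 * L2norm (fun x => u x 2) + K * Real.sqrt (2 * R)) := by
    rw [ENNReal.ofReal_add (by positivity) (by positivity),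
      ENNReal.ofReal_add (by positivity) (by positivity), ← n1, ← n2, ← n3]
    refine (eLpNorm_mono_real hb).trans ?_
    refine (eLpNorm_add_le (m1.add m2).1 m3.1 (by norm_num)).trans ?_
    gcongr
    exact eLpNorm_add_le m1.1 m2.1 (by norm_num)
  exact ENNReal.toReal_le_of_le_ofReal (by positivity) tot

/-- if m₁ is not constant, ℋ¹-closeness to m implies H¹-closeness, and in
    particular identical limits at ±∞. -/
theorem HH1_close_implies_H1_close (m : ℝ → E3)
    (hreg : ContDiff ℝ 1 m) (hsph : ∀ x, ‖m x‖ = 1)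
    (h2 : MemLp (fun x => m x 1) 2 volume) (h3 : MemLp (fun x => m x 2) 2 volume)
    (hd : MemLp (deriv m) 2 volume)
    (hnc : ¬ ∃ c : ℝ, ∀ x : ℝ, m x 0 = c) :
    ∀ ε > (0:ℝ), ∃ δ > (0:ℝ), ∀ mt : ℝ → E3,
      ContDiff ℝ 1 mt → (∀ x, ‖mt x‖ = 1) →
      MemLp (fun x => mt x 1) 2 volume → MemLp (fun x => mt x 2) 2 volume →
      MemLp (deriv mt) 2 volume →
      HH1 (fun x => m x - mt x) ≤ δ →
      MemLp (fun x => m x - mt x) 2 volume ∧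
      H1norm (fun x => m x - mt x) ≤ ε ∧
      (∃ p : E3, Tendsto m atTop (nhds p) ∧ Tendsto mt atTop (nhds p)) ∧
      (∃ q : E3, Tendsto m atBot (nhds q) ∧ Tendsto mt atBot (nhds q)) := by
  intro ε hε
  have hmc := hreg.continuous
  have hc0 : Continuous (fun x => m x 0) := by fun_prop
  obtain ⟨a, b, ha, hb, hab⟩ := aux_two_points _ hc0 hnc
  obtain ⟨⟨p, hp⟩, R1, hR1⟩ := aux_limit m hreg hsph h2 h3 hd
  obtain ⟨⟨q, hq⟩, ⟨R2, hR2⟩, -, -⟩ := aux_limit_bot m hreg hsph h2 h3 hd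
  obtain ⟨R, hR0, hRp, hRm⟩ : ∃ R : ℝ, 0 ≤ R ∧ (∀ x ≥ R, 3 / 4 ≤ |m x 0|) ∧
      (∀ x ≤ -R, 3 / 4 ≤ |m x 0|) := by
    refine ⟨max 0 (max R1 R2), le_max_left _ _, fun x hx => hR1 x ?_, fun x hx => hR2 x ?_⟩
    · exact ((le_max_left _ _).trans (le_max_right _ _)).trans hx
    · have : R2 ≤ max 0 (max R1 R2) := (le_max_right _ _).trans (le_max_right _ _)
      linarith
  obtain ⟨κ, hκ, hκa, hκb, hκab⟩ : ∃ κ > 0, κ ≤ |m a 0| ∧ κ ≤ |m b 0| ∧ κ ≤ |m a 0 - m b 0| := by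
    refine ⟨min |m a 0| (min |m b 0| |m a 0 - m b 0|), ?_, min_le_left _ _,
      (min_le_right _ _).trans (min_le_left _ _), (min_le_right _ _).trans (min_le_right _ _)⟩
    exact lt_min (abs_pos.2 ha) (lt_min (abs_pos.2 hb) (abs_pos.2 (sub_ne_zero.2 hab)))
  set L := Real.sqrt |b - a| with hL
  have hL0 : 0 ≤ L := Real.sqrt_nonneg _
  set K1 := 4 / κ + Real.sqrt (|a| + R) with hK1
  have hK10 : 0 ≤ K1 := by positivity
  -- choice of δ
  obtain ⟨δ, hδ0, hδ1, hδ2, hδ3, hδ4⟩ : ∃ δ > 0, δ * (8 / κ + L) < κ ∧ δ * K1 ≤ 1 / 2 ∧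
      4 * δ < 1 / 2 ∧ δ * (4 + K1 * Real.sqrt (2 * R)) ≤ ε := by
    set A := 8 / κ + L with hA
    set B := 4 + K1 * Real.sqrt (2 * R) with hB
    have hA0 : 0 < A := by positivity
    have hB0 : 0 < B := by positivity
    have ev : ∀ C : ℝ, Tendsto (fun δ : ℝ => δ * C) (nhdsWithin 0 (Set.Ioi 0)) (nhds 0) := by
      intro C
      have : Tendsto (fun δ : ℝ => δ * C) (nhds 0) (nhds (0 * C)) :=
        (continuous_id.mul continuous_const).tendsto 0
      rw [zero_mul] at this
      exact this.mono_left nhdsWithin_le_nhds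
    obtain ⟨δ, h⟩ := (((ev A).eventually (gt_mem_nhds hκ)).and
      (((ev K1).eventually (gt_mem_nhds (by norm_num : (0:ℝ) < 1 / 2))).and
      (((ev 4).eventually (gt_mem_nhds (by norm_num : (0:ℝ) < 1 / 2))).and
      (((ev B).eventually (gt_mem_nhds hε)).and self_mem_nhdsWithin)))).exists
    exact ⟨δ, h.2.2.2.2, h.1, h.2.1.le, by linarith [h.2.2.1], h.2.2.2.1.le⟩
  refine ⟨δ, hδ0, ?_⟩
  intro mt htreg htsph ht2 ht3 htd hclose
  set u : ℝ → E3 := fun x => m x - mt x with hu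
  have hureg : ContDiff ℝ 1 u := hreg.sub htreg
  have huc := hureg.continuous
  have hud : MemLp (deriv u) 2 volume := by
    have : deriv u = deriv m - deriv mt := by
      funext x
      exact deriv_sub (hreg.differentiable (by norm_num) x) (htreg.differentiable (by norm_num) x)
    rw [this]; exact hd.sub htd
  have hu2 : MemLp (fun x => u x 1) 2 volume := h2.sub ht2
  have hu3 : MemLp (fun x => u x 2) 2 volume := h3.sub ht3
  have q1 : 0 ≤ L2norm (fun x => u x 1) := ENNReal.toReal_nonneg
  have q2 : 0 ≤ L2norm (fun x => u x 2) := ENNReal.toReal_nonneg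
  have q3 : 0 ≤ L2norm (deriv u) := ENNReal.toReal_nonneg
  have hclose' : L2norm (fun x => u x 1) + L2norm (fun x => u x 2) + L2norm (deriv u) ≤ δ := hclose
  have hold : ∀ i x y, |u y i - u x i| ≤ L2norm (deriv u) * Real.sqrt |y - x| := fun i x y =>
    (aux_coord_le (u y - u x) i).trans (aux_holder u hureg hud x y)
  have s1 : ∀ x, |u x 1| ≤ δ := fun x => (aux_sup _ _ hu2 (hold 1) x).trans (by linarith)
  have s2 : ∀ x, |u x 2| ≤ δ := fun x => (aux_sup _ _ hu3 (hold 2) x).trans (by linarith)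
  have prod : ∀ x, |u x 0| * |2 * m x 0 - u x 0| ≤ 2 * |u x 1| + 2 * |u x 2| := by
    intro x
    have e1 := aux_norm_sq (m x)
    have e2 := aux_norm_sq (mt x)
    rw [hsph] at e1
    rw [htsph] at e2
    have hui : ∀ i, u x i = m x i - mt x i := fun i => rfl
    have b1 : ∀ i, |m x i + mt x i| ≤ 2 := fun i => by
      have := aux_coord_le (m x) i
      have := aux_coord_le (mt x) i
      have := abs_add_le (m x i) (mt x i)
      linarith [hsph x, htsph x]
    have e3 : u x 0 * (2 * m x 0 - u x 0) =
        -(u x 1 * (m x 1 + mt x 1)) - u x 2 * (m x 2 + mt x 2) := by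
      simp only [hui]; linarith
    rw [← abs_mul, e3]
    have c1 : |u x 1 * (m x 1 + mt x 1)| ≤ 2 * |u x 1| := by
      rw [abs_mul]; nlinarith [b1 1, abs_nonneg (u x 1)]
    have c2 : |u x 2 * (m x 2 + mt x 2)| ≤ 2 * |u x 2| := by
      rw [abs_mul]; nlinarith [b1 2, abs_nonneg (u x 2)]
    have := abs_sub (-(u x 1 * (m x 1 + mt x 1))) (u x 2 * (m x 2 + mt x 2))
    rw [abs_neg] at this
    linarith
  have prod' : ∀ x, |u x 0| * |2 * m x 0 - u x 0| ≤ 4 * δ := fun x => by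
    linarith [prod x, s1 x, s2 x]
  have hua : |u a 0| ≤ 4 * δ / κ := by
    refine aux_small _ _ κ _ (u b 0) δ L hκ hκa hκb hκab hδ1 hL0 hδ0 (prod' a) (prod' b) ?_
    refine (hold 0 a b).trans ?_
    gcongr
    linarith
  have hin : ∀ x ∈ Set.Icc (-R) R, |u x 0| ≤ δ * K1 := by
    intro x hx
    have h1 := hold 0 a x
    have h4 : |x - a| ≤ |a| + R := by
      have := abs_sub x a
      have : |x| ≤ R := abs_le.2 hx
      linarith
    have h5 : L2norm (deriv u) * Real.sqrt |x - a| ≤ δ * Real.sqrt (|a| + R) := by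
      gcongr
      linarith
    have h6 := abs_sub_abs_le_abs_sub (u x 0) (u a 0)
    have h7 : δ * K1 = 4 * δ / κ + δ * Real.sqrt (|a| + R) := by rw [hK1]; ring
    linarith
  have hu0c : Continuous (fun x => u x 0) := by fun_prop
  have hhalf : ∀ x, x ∉ Set.Ioo (-R) R → |u x 0| ≤ 1 / 2 ∧ 3 / 4 ≤ |m x 0| := by
    intro x hx
    by_cases hx1 : R ≤ x
    · refine ⟨aux_prop (fun x => u x 0) (fun x => m x 0) R hu0c hRp
        (fun y => (prod' y).trans_lt hδ3) ?_ x hx1, hRp x hx1⟩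
      exact (hin R ⟨by linarith, le_rfl⟩).trans hδ2
    · have hx2 : x ≤ -R := by
        by_contra h
        push Not at h hx1
        exact hx ⟨h, hx1⟩
      refine ⟨?_, hRm x hx2⟩
      have := aux_prop (fun x => u (-x) 0) (fun x => m (-x) 0) R (hu0c.comp continuous_neg)
        (fun y hy => hRm (-y) (by linarith)) (fun y => (prod' (-y)).trans_lt hδ3)
        ((hin (-R) ⟨le_rfl, by linarith⟩).trans hδ2) (-x) (by linarith)
      simpa using this
  have hout : ∀ x, x ∉ Set.Ioo (-R) R → |u x 0| ≤ 2 * |u x 1| + 2 * |u x 2| := by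
    intro x hx
    obtain ⟨h1, h4⟩ := hhalf x hx
    have h5 := abs_sub_abs_le_abs_sub (2 * m x 0) (u x 0)
    rw [abs_mul, abs_two] at h5
    nlinarith [prod x, abs_nonneg (u x 0)]
  obtain ⟨hL2, hL2n⟩ := aux_L2 u huc R (δ * K1) hR0 (by positivity) hu2 hu3 hin
    (fun x hx => hout x (fun h => hx (Set.Ioo_subset_Icc_self h)))
  have lim : ∀ (l : Filter ℝ), (∀ᶠ x in l, x ∉ Set.Ioo (-R) R) →
      Tendsto (fun x => u x 1) l (nhds 0) → Tendsto (fun x => u x 2) l (nhds 0) →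
      ∀ p, Tendsto m l (nhds p) → Tendsto mt l (nhds p) := by
    intro l hl t1 t2 p hp
    have t0 : Tendsto (fun x => u x 0) l (nhds 0) := by
      refine squeeze_zero_norm' (a := fun x => 2 * |u x 1| + 2 * |u x 2|) ?_ ?_
      · filter_upwards [hl] with x hx using hout x hx
      · simpa using (t1.abs.const_mul 2).add (t2.abs.const_mul 2)
    have t : Tendsto u l (nhds 0) := by
      refine aux_tendsto_pi _ _ _ fun i => ?_
      fin_cases i
      · exact t0
      · exact t1
      · exact t2
    have := hp.sub t
    simpa [hu] using this
  refine ⟨hL2, ?_, ⟨p, hp, ?_⟩, ⟨q, hq, ?_⟩⟩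
  · have : δ * (4 + K1 * Real.sqrt (2 * R)) = 4 * δ + δ * K1 * Real.sqrt (2 * R) := by ring
    unfold H1norm
    linarith
  · refine lim atTop ?_ (aux_tendsto_coord u hureg hud 1 hu2)
      (aux_tendsto_coord u hureg hud 2 hu3) p hp
    filter_upwards [eventually_ge_atTop R] with x hx h
    linarith [h.2]
  · obtain ⟨-, -, v1, v2⟩ := aux_limit_bot m hreg hsph h2 h3 hd
    obtain ⟨-, -, w1, w2⟩ := aux_limit_bot mt htreg htsph ht2 ht3 htd
    refine lim atBot ?_ (by simpa [hu] using v1.sub w1) (by simpa [hu] using v2.sub w2) q hq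
    filter_upwards [eventually_le_atBot (-R)] with x hx h
    linarith [h.1]
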